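/- arXiv:cs/0607033 — 2 statements merged into one kernel-verified Lean document; each statement's English description precedes it below -/
import Mathlib

section
/- Let G be a connected graph, s ≠ t vertices, and S₀(s,t) the union of the vertex sets of all shortest s-t paths. Then no three distinct blocks of the induced subgraph G[S₀(s,t)] share a common cut vertex. -/
/-- The set of vertices lying on at least one shortest `s`-`t` path of `G`. -/
def shortestPathVerts {V : Type*} (G : SimpleGraph V) (s t : V) : Set V :=
  {a | ∃ p : G.Walk s t, p.IsPath ∧ p.length = G.dist s t ∧ a ∈ p.support}

/-- `c` is a cut vertex of the subgraph of `G` induced on `S`. -/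
def IsCutVertexOn {V : Type*} (G : SimpleGraph V) (S : Set V) (c : V) : Prop :=
  c ∈ S ∧ (G.induce S).Connected ∧ ¬ (G.induce (S \ {c})).Preconnected

/-- `B` induces a connected subgraph of `G` without cut vertices. -/
def IsBiconnectedOn {V : Type*} (G : SimpleGraph V) (B : Set V) : Prop :=
  (G.induce B).Connected ∧ ∀ c : V, ¬ IsCutVertexOn G B c

/-- `B` is a block of the subgraph of `G` induced on `S`: a maximal subset of `S`
inducing a connected subgraph with no cut vertex. -/
def IsBlockOn {V : Type*} (G : SimpleGraph V) (S : Set V) (B : Set V) : Prop :=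
  B ⊆ S ∧ IsBiconnectedOn G B ∧
    ∀ B' : Set V, B ⊆ B' → B' ⊆ S → IsBiconnectedOn G B' → B' = B

/-- `u` and `v` are joined by a walk inside `T`. -/
def WalkIn {V : Type*} (G : SimpleGraph V) (T : Set V) (u v : V) : Prop :=
  ∃ p : G.Walk u v, ∀ x ∈ p.support, x ∈ T

theorem WalkIn.symm {V : Type*} {G : SimpleGraph V} {T : Set V} {u v : V}
    (h : WalkIn G T u v) : WalkIn G T v u := by
  obtain ⟨p, hp⟩ := h
  exact ⟨p.reverse, fun x hx => hp x (by simpa using hx)⟩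

theorem WalkIn.trans {V : Type*} {G : SimpleGraph V} {T : Set V} {u v w : V}
    (h : WalkIn G T u v) (h' : WalkIn G T v w) : WalkIn G T u w := by
  obtain ⟨p, hp⟩ := h
  obtain ⟨q, hq⟩ := h'
  refine ⟨p.append q, fun x hx => ?_⟩
  rcases (SimpleGraph.Walk.mem_support_append_iff _ _).1 hx with h | h
  · exact hp x h
  · exact hq x h

theorem WalkIn.mono {V : Type*} {G : SimpleGraph V} {T T' : Set V} {u v : V}
    (h : WalkIn G T u v) (hT : T ⊆ T') : WalkIn G T' u v := by
  obtain ⟨p, hp⟩ := h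
  exact ⟨p, fun x hx => hT (hp x hx)⟩

theorem preconn_iff {V : Type*} {G : SimpleGraph V} {T : Set V} :
    (G.induce T).Preconnected ↔ ∀ u ∈ T, ∀ v ∈ T, WalkIn G T u v := by
  constructor
  · intro h u hu v hv
    obtain ⟨p⟩ := h ⟨u, hu⟩ ⟨v, hv⟩
    refine ⟨p.map (SimpleGraph.Embedding.induce T).toHom, fun x hx => ?_⟩
    have hx' := (SimpleGraph.Walk.support_map (SimpleGraph.Embedding.induce T).toHom p) ▸ hx
    obtain ⟨a, _, rfl⟩ := List.mem_map.1 hx'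
    exact a.2
  · rintro h ⟨u, hu⟩ ⟨v, hv⟩
    obtain ⟨p, hp⟩ := h u hu v hv
    exact ⟨p.induce T hp⟩

/-- On a path, removing `x` leaves every other vertex joined to one of the ends. -/
theorem path_split {V : Type*} {G : SimpleGraph V} {u w v x : V} (p : G.Walk u w)
    (hp : p.IsPath) (hv : v ∈ p.support) (hx : v ≠ x) :
    WalkIn G ({a | a ∈ p.support} \ {x}) v u ∨ WalkIn G ({a | a ∈ p.support} \ {x}) v w := by
  classical
  by_cases h1 : x ∈ (p.takeUntil v hv).support
  · right
    refine ⟨p.dropUntil v hv, fun a ha => ⟨p.support_dropUntil_subset_support hv ha, ?_⟩⟩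
    rintro rfl
    have hn := hp.support_nodup
    rw [← p.take_spec hv, SimpleGraph.Walk.support_append] at hn
    have hd := (List.nodup_append.1 hn).2.2
    rw [SimpleGraph.Walk.mem_support_iff] at ha
    rcases ha with ha | ha
    · exact hx ha.symm
    · exact hd _ h1 _ ha rfl
  · left
    refine WalkIn.symm ⟨p.takeUntil v hv, fun a ha => ⟨p.support_takeUntil_subset_support hv ha, ?_⟩⟩
    rintro rfl
    exact h1 ha

theorem bicon_diff {V : Type*} {G : SimpleGraph V} {B : Set V} (h : IsBiconnectedOn G B)
    (c : V) {u v : V} (hu : u ∈ B) (hv : v ∈ B) (huc : u ≠ c) (hvc : v ≠ c) :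
    WalkIn G (B \ {c}) u v := by
  by_cases hc : c ∈ B
  · have := h.2 c
    unfold IsCutVertexOn at this
    have h2 : (G.induce (B \ {c})).Preconnected := by
      by_contra h3
      exact this ⟨hc, h.1, h3⟩
    exact preconn_iff.1 h2 u ⟨hu, huc⟩ v ⟨hv, hvc⟩
  · have := preconn_iff.1 h.1.preconnected u hu v hv
    exact this.mono fun a ha => ⟨ha, fun e => hc (e ▸ ha)⟩

/-- Two blocks sharing `c` whose remainders are joined outside `c` coincide. -/
theorem block_eq {V : Type*} {G : SimpleGraph V} {S B₁ B₂ : Set V} {c b₁ b₂ : V}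
    (h₁ : IsBlockOn G S B₁) (h₂ : IsBlockOn G S B₂) (hc₁ : c ∈ B₁) (hc₂ : c ∈ B₂)
    (hb₁ : b₁ ∈ B₁) (hb₂ : b₂ ∈ B₂) (hn₁ : b₁ ≠ c) (hn₂ : b₂ ≠ c)
    (hw : WalkIn G (S \ {c}) b₁ b₂) : B₁ = B₂ := by
  classical
  obtain ⟨p, hp⟩ : ∃ p : G.Walk b₁ b₂, p.IsPath ∧ ∀ x ∈ p.support, x ∈ S \ {c} := by
    obtain ⟨p, hp⟩ := hw
    exact ⟨p.bypass, p.bypass_isPath, fun x hx => hp x (p.support_bypass_subset_support hx)⟩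
  obtain ⟨hpath, hpS⟩ := hp
  set B : Set V := B₁ ∪ B₂ ∪ {a | a ∈ p.support} with hB
  have s1 : B₁ ⊆ B := fun a ha => Or.inl (Or.inl ha)
  have s2 : B₂ ⊆ B := fun a ha => Or.inl (Or.inr ha)
  have s3 : {a | a ∈ p.support} ⊆ B := fun a ha => Or.inr ha
  have hBS : B ⊆ S := by
    rintro a ((ha | ha) | ha)
    · exact h₁.1 ha
    · exact h₂.1 ha
    · exact (hpS a ha).1
  -- everything is joined to a hub after deleting `x`
  have hub : ∀ x : V, ∃ z, ∀ v ∈ B, v ≠ x → WalkIn G (B \ {x}) v z := by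
    intro x
    have m1 := Set.sdiff_subset_sdiff_left (t := {x}) s1
    have m2 := Set.sdiff_subset_sdiff_left (t := {x}) s2
    have m3 := Set.sdiff_subset_sdiff_left (t := {x}) s3
    by_cases hxc : x = c
    · subst hxc
      have hP : WalkIn G (B \ {x}) b₁ b₂ :=
        ⟨p, fun a ha => ⟨s3 ha, (hpS a ha).2⟩⟩
      refine ⟨b₁, ?_⟩
      rintro v ((hv | hv) | hv) hvx
      · exact (bicon_diff h₁.2.1 x hv hb₁ hvx hn₁).mono m1
      · exact ((bicon_diff h₂.2.1 x hv hb₂ hvx hn₂).mono m2).trans hP.symm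
      · rcases path_split p hpath hv hvx with h | h
        · exact h.mono m3
        · exact (h.mono m3).trans hP.symm
    · have hcx : c ≠ x := fun e => hxc e.symm
      have k1 : ∀ v ∈ B₁, v ≠ x → WalkIn G (B \ {x}) v c := fun v hv hvx =>
        (bicon_diff h₁.2.1 x hv hc₁ hvx hcx).mono m1
      have k2 : ∀ v ∈ B₂, v ≠ x → WalkIn G (B \ {x}) v c := fun v hv hvx =>
        (bicon_diff h₂.2.1 x hv hc₂ hvx hcx).mono m2
      refine ⟨c, ?_⟩
      rintro v ((hv | hv) | hv) hvx
      · exact k1 v hv hvx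
      · exact k2 v hv hvx
      · have ne : ∀ {y}, WalkIn G (B \ {x}) v y → y ≠ x := fun ⟨q, hq⟩ =>
          (hq _ q.end_mem_support).2
        rcases path_split p hpath hv hvx with h | h
        · have h := h.mono m3
          exact h.trans (k1 _ hb₁ (ne h))
        · have h := h.mono m3
          exact h.trans (k2 _ hb₂ (ne h))
  have hbic : IsBiconnectedOn G B := by
    constructor
    · have k1 : ∀ v ∈ B₁, WalkIn G B v c := fun v hv =>
        (preconn_iff.1 h₁.2.1.1.preconnected v hv c hc₁).mono s1
      have k2 : ∀ v ∈ B₂, WalkIn G B v c := fun v hv =>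
        (preconn_iff.1 h₂.2.1.1.preconnected v hv c hc₂).mono s2
      have k : ∀ v ∈ B, WalkIn G B v c := by
        rintro v ((hv | hv) | hv)
        · exact k1 v hv
        · exact k2 v hv
        · have hvc : v ≠ c := (hpS v hv).2
          rcases path_split p hpath hv hvc with h | h
          · exact (h.mono (Set.diff_subset.trans s3)).trans (k1 _ hb₁)
          · exact (h.mono (Set.diff_subset.trans s3)).trans (k2 _ hb₂)
      haveI : Nonempty B := ⟨⟨c, s1 hc₁⟩⟩
      exact ⟨preconn_iff.2 fun u hu v hv => (k u hu).trans (k v hv).symm⟩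
    · rintro x ⟨_, _, h⟩
      apply h
      obtain ⟨z, hz⟩ := hub x
      exact preconn_iff.2 fun u hu v hv => (hz u hu.1 hu.2).trans (hz v hv.1 hv.2).symm
  exact (h₁.2.2 B s1 hBS hbic).symm.trans (h₂.2.2 B s2 hBS hbic)

/-- A block meeting another block in `c` has a vertex other than `c`. -/
theorem block_other {V : Type*} {G : SimpleGraph V} {S B₁ B₂ : Set V} {c : V}
    (h₁ : IsBlockOn G S B₁) (h₂ : IsBlockOn G S B₂) (hc₂ : c ∈ B₂)
    (hne : B₁ ≠ B₂) : ∃ b ∈ B₁, b ≠ c := by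
  by_contra hcon
  push Not at hcon
  exact hne (h₁.2.2 B₂ (fun a ha => hcon a ha ▸ hc₂) h₂.1 h₂.2.1).symm

/-- No three distinct blocks of `G[S₀(s,t)]` share a common cut vertex. -/
theorem stmt_6 {V : Type*} [Fintype V] (G : SimpleGraph V) (hG : G.Connected)
    (s t : V) (hst : s ≠ t) :
    ¬ ∃ (B₁ B₂ B₃ : Set V) (c : V),
        IsBlockOn G (shortestPathVerts G s t) B₁ ∧
        IsBlockOn G (shortestPathVerts G s t) B₂ ∧
        IsBlockOn G (shortestPathVerts G s t) B₃ ∧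
        B₁ ≠ B₂ ∧ B₁ ≠ B₃ ∧ B₂ ≠ B₃ ∧
        IsCutVertexOn G (shortestPathVerts G s t) c ∧
        c ∈ B₁ ∧ c ∈ B₂ ∧ c ∈ B₃ := by
  rintro ⟨B₁, B₂, B₃, c, h₁, h₂, h₃, n12, n13, n23, -, c1, c2, c3⟩
  obtain ⟨b₁, hb₁, hn₁⟩ := block_other h₁ h₂ c2 n12
  obtain ⟨b₂, hb₂, hn₂⟩ := block_other h₂ h₁ c1 n12.symm
  obtain ⟨b₃, hb₃, hn₃⟩ := block_other h₃ h₁ c1 n13.symm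
  have key : ∀ v ∈ shortestPathVerts G s t, v ≠ c →
      WalkIn G (shortestPathVerts G s t \ {c}) v s ∨
      WalkIn G (shortestPathVerts G s t \ {c}) v t := by
    rintro v ⟨p, hp, hl, hv⟩ hvc
    have hm : {a | a ∈ p.support} \ {c} ⊆ shortestPathVerts G s t \ {c} :=
      Set.sdiff_subset_sdiff_left fun a ha => ⟨p, hp, hl, ha⟩
    exact (path_split p hp hv hvc).imp (fun h => h.mono hm) (fun h => h.mono hm)
  have e12 := fun h => n12 (block_eq h₁ h₂ c1 c2 hb₁ hb₂ hn₁ hn₂ h)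
  have e13 := fun h => n13 (block_eq h₁ h₃ c1 c3 hb₁ hb₃ hn₁ hn₃ h)
  have e23 := fun h => n23 (block_eq h₂ h₃ c2 c3 hb₂ hb₃ hn₂ hn₃ h)
  rcases key b₁ (h₁.1 hb₁) hn₁ with k1 | k1 <;>
  rcases key b₂ (h₂.1 hb₂) hn₂ with k2 | k2 <;>
  rcases key b₃ (h₃.1 hb₃) hn₃ with k3 | k3 <;>
  first
  | exact e12 (k1.trans k2.symm)
  | exact e13 (k1.trans k3.symm)
  | exact e23 (k2.trans k3.symm)
end

section
/- Let G be a connected graph, s ≠ t vertices, and H = G[S₀(s,t)] the subgraph induced on the union of all shortest s-t paths. Then the block structure of H is a path: every cut vertex of H belongs to exactly two blocks, and every block of H contains at most two cut vertices of H. -/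
namespace Stmt7

/-- Reachability inside an induced subgraph. -/
def Reach {V : Type*} (G : SimpleGraph V) (T : Set V) (u v : V) : Prop :=
  ∃ (hu : u ∈ T) (hv : v ∈ T), (G.induce T).Reachable ⟨u, hu⟩ ⟨v, hv⟩

/-- A layered set of vertices. -/
structure Layered {V : Type*} (G : SimpleGraph V) (S : Set V) (f : V → ℕ) (d : ℕ) : Prop where
  down : ∀ v ∈ S, 0 < f v → ∃ w ∈ S, G.Adj v w ∧ f w + 1 = f v
  up : ∀ v ∈ S, f v < d → ∃ w ∈ S, G.Adj v w ∧ f w = f v + 1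
  le : ∀ v ∈ S, f v ≤ d
  lip : ∀ u v, G.Adj u v → f u ≤ f v + 1

/-- The layer `k` consists of the single vertex `x`. -/
def Sep {V : Type*} (S : Set V) (f : V → ℕ) (k : ℕ) (x : V) : Prop :=
  x ∈ S ∧ f x = k ∧ ∀ y ∈ S, f y = k → y = x

/-- The vertices in layers `a` to `b`. -/
def Itv {V : Type*} (S : Set V) (f : V → ℕ) (a b : ℕ) : Set V :=
  {v | v ∈ S ∧ a ≤ f v ∧ f v ≤ b}

variable {V : Type*} {G : SimpleGraph V} {S T : Set V} {f : V → ℕ} {d : ℕ}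

theorem Reach.refl {u : V} (hu : u ∈ T) : Reach G T u u := ⟨hu, hu, SimpleGraph.Reachable.refl _⟩

theorem Reach.symm {u v : V} (h : Reach G T u v) : Reach G T v u := by
  obtain ⟨a, b, h⟩ := h
  exact ⟨b, a, h.symm⟩

theorem Reach.trans {u v w : V} (h : Reach G T u v) (h' : Reach G T v w) : Reach G T u w := by
  obtain ⟨a, b, h⟩ := h
  obtain ⟨_, c, h'⟩ := h'
  exact ⟨a, c, h.trans h'⟩

theorem Reach.adj {u v : V} (hu : u ∈ T) (hv : v ∈ T) (h : G.Adj u v) : Reach G T u v :=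
  ⟨hu, hv, SimpleGraph.Adj.reachable (by simpa using h)⟩

theorem preconn_iff : (G.induce T).Preconnected ↔ ∀ u ∈ T, ∀ v ∈ T, Reach G T u v := by
  constructor
  · intro h u hu v hv
    exact ⟨hu, hv, h _ _⟩
  · rintro h ⟨u, hu⟩ ⟨v, hv⟩
    exact (h u hu v hv).2.2

theorem desc (L : Layered G S f d) (a : ℕ) : ∀ n v, f v = a + n → v ∈ T → v ∈ S →
    (∀ w ∈ S, a ≤ f w → f w < f v → w ∈ T) → ∃ x ∈ S, f x = a ∧ Reach G T v x := by
  intro n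
  induction n with
  | zero => intro v hv hT hS _; exact ⟨v, hS, hv, Reach.refl hT⟩
  | succ n ih =>
    intro v hv hT hS hw
    obtain ⟨w, wS, hadj, hf⟩ := L.down v hS (by omega)
    have wT := hw w wS (by omega) (by omega)
    obtain ⟨x, xS, hx, hr⟩ := ih w (by omega) wT wS
      (fun y yS h1 h2 => hw y yS h1 (by omega))
    exact ⟨x, xS, hx, (Reach.adj hT wT hadj).trans hr⟩

theorem asc (L : Layered G S f d) (b : ℕ) (hb : b ≤ d) : ∀ n v, f v + n = b → v ∈ T → v ∈ S →
    (∀ w ∈ S, f w ≤ b → f v < f w → w ∈ T) → ∃ x ∈ S, f x = b ∧ Reach G T v x := by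
  intro n
  induction n with
  | zero => intro v hv hT hS _; exact ⟨v, hS, hv, Reach.refl hT⟩
  | succ n ih =>
    intro v hv hT hS hw
    obtain ⟨w, wS, hadj, hf⟩ := L.up v hS (by omega)
    have wT := hw w wS (by omega) (by omega)
    obtain ⟨x, xS, hx, hr⟩ := ih w (by omega) wT wS
      (fun y yS h1 h2 => hw y yS h1 (by omega))
    exact ⟨x, xS, hx, (Reach.adj hT wT hadj).trans hr⟩

theorem side (L : Layered G S f d) {k : ℕ} (hk : ∀ w ∈ T, f w ≠ k) {u v : V}
    (h : Reach G T u v) (hu : f u < k) : f v < k := by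
  obtain ⟨a, b, ⟨p⟩⟩ := h
  have key : ∀ (x y : T) (p : (G.induce T).Walk x y), f x.1 < k → f y.1 < k := by
    intro x y p
    induction p with
    | nil => exact id
    | @cons x z y h p ih =>
      intro hx
      apply ih
      have h1 := L.lip z.1 x.1 (by simpa using h.symm)
      have h2 := hk z.1 z.2
      omega
  exact key _ _ p hu

theorem no_cross (L : Layered G S f d) {B : Set V} (hB : IsBiconnectedOn G B) (hBS : B ⊆ S)
    {k : ℕ} {x : V} (hx : Sep S f k x) {u v : V} (hu : u ∈ B) (hv : v ∈ B)
    (huk : f u < k) (hvk : k < f v) : False := by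
  have hxB : x ∈ B := by
    by_contra hxB
    have := side L (T := B) (k := k) (fun w hw h => hxB (hx.2.2 w (hBS hw) h ▸ hw))
      (preconn_iff.1 hB.1.preconnected u hu v hv) huk
    omega
  refine hB.2 x ⟨hxB, hB.1, fun hp => ?_⟩
  have hxk := hx.2.1
  have := side L (T := B \ {x}) (k := k) (fun w hw h => hw.2 (hx.2.2 w (hBS hw.1) h))
      (preconn_iff.1 hp u ⟨hu, by rintro rfl; omega⟩ v ⟨hv, by rintro rfl; omega⟩) huk
  omega

theorem core (L : Layered G S f d) {a b : ℕ} {x y : V} (hx : Sep S f a x) (hy : Sep S f b y)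
    {c : V} (hc : c ∈ Itv S f a b)
    (h : f c = a ∨ f c = b ∨ ∃ u ∈ S, u ≠ c ∧ f u = f c) :
    (G.induce (Itv S f a b \ {c})).Preconnected := by
  have hbd : b ≤ d := hy.2.1 ▸ L.le y hy.1
  obtain ⟨hcS, hca, hcb⟩ := hc
  have D : ∀ v ∈ Itv S f a b \ {c}, f v ≤ f c → Reach G (Itv S f a b \ {c}) v x := by
    intro v hv hvc
    obtain ⟨z, zS, hz, hr⟩ := desc (T := Itv S f a b \ {c}) L a (f v - a) v
      (by have := hv.1.2.1; omega) hv hv.1.1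
      (fun w wS h1 h2 => ⟨⟨wS, h1, by omega⟩, by rintro rfl; omega⟩)
    rwa [hx.2.2 z zS hz] at hr
  have U : ∀ v ∈ Itv S f a b \ {c}, f c ≤ f v → Reach G (Itv S f a b \ {c}) v y := by
    intro v hv hvc
    obtain ⟨z, zS, hz, hr⟩ := asc (T := Itv S f a b \ {c}) L b hbd (b - f v) v
      (by have := hv.1.2.2; omega) hv hv.1.1
      (fun w wS h1 h2 => ⟨⟨wS, by omega, h1⟩, by rintro rfl; omega⟩)
    rwa [hy.2.2 z zS hz] at hr
  rw [preconn_iff]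
  rcases h with h | h | ⟨w, wS, wc, hw⟩
  · intro u hu v hv
    exact (U u hu (by have := hu.1.2.1; omega)).trans (U v hv (by have := hv.1.2.1; omega)).symm
  · intro u hu v hv
    exact (D u hu (by have := hu.1.2.2; omega)).trans (D v hv (by have := hv.1.2.2; omega)).symm
  · have wI : w ∈ Itv S f a b \ {c} := ⟨⟨wS, by omega, by omega⟩, wc⟩
    have key : ∀ v ∈ Itv S f a b \ {c}, Reach G (Itv S f a b \ {c}) v w := by
      intro v hv
      rcases le_total (f v) (f c) with h | h
      · exact (D v hv h).trans (D w wI hw.le).symm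
      · exact (U v hv h).trans (U w wI hw.ge).symm
    intro u hu v hv
    exact (key u hu).trans (key v hv).symm

theorem itv_conn (L : Layered G S f d) {a b : ℕ} {x : V} (hx : Sep S f a x) (hab : a ≤ b) :
    (G.induce (Itv S f a b)).Connected := by
  have hxI : x ∈ Itv S f a b := ⟨hx.1, hx.2.1.ge, hx.2.1.trans_le hab⟩
  have D : ∀ v ∈ Itv S f a b, Reach G (Itv S f a b) v x := by
    intro v hv
    obtain ⟨z, zS, hz, hr⟩ := desc (T := Itv S f a b) L a (f v - a) v
      (by have := hv.2.1; omega) hv hv.1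
      (fun w wS h1 h2 => ⟨wS, h1, by have := hv.2.2; omega⟩)
    rwa [hx.2.2 z zS hz] at hr
  exact { preconnected := preconn_iff.2 fun u hu v hv => (D u hu).trans (D v hv).symm
          nonempty := ⟨⟨x, hxI⟩⟩ }

theorem itv_block (L : Layered G S f d) {a b : ℕ} {x y : V} (hx : Sep S f a x)
    (hy : Sep S f b y) (hab : a < b) (hno : ∀ k, a < k → k < b → ∀ z, ¬ Sep S f k z) :
    IsBlockOn G S (Itv S f a b) := by
  have hxI : x ∈ Itv S f a b := ⟨hx.1, hx.2.1.ge, hx.2.1.trans_le hab.le⟩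
  have hyI : y ∈ Itv S f a b := ⟨hy.1, hab.le.trans hy.2.1.ge, hy.2.1.le⟩
  refine ⟨fun v hv => hv.1, ⟨itv_conn L hx hab.le, ?_⟩, ?_⟩
  · rintro c ⟨hc, _, hn⟩
    apply hn
    apply core L hx hy hc
    by_contra! hcon
    obtain ⟨h1, h2, h3⟩ := hcon
    have h4 := hc.2.1
    have h5 := hc.2.2
    refine hno (f c) (by omega) (by omega) c ⟨hc.1, rfl, fun u uS hu => ?_⟩
    by_contra huc
    exact h3 u uS huc hu
  · intro B' hB hBS hbi
    refine Set.Subset.antisymm (fun v hv => ⟨hBS hv, ?_, ?_⟩) hB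
    · by_contra! h
      exact no_cross L hbi hBS hx hv (hB hyI) h (by rw [hy.2.1]; exact hab)
    · by_contra! h
      exact no_cross L hbi hBS hy (hB hxI) hv (by rw [hx.2.1]; exact hab) h

theorem cut_sep (L : Layered G S f d) {x y : V} (hx : Sep S f 0 x) (hy : Sep S f d y)
    {c : V} (hc : IsCutVertexOn G S c) : 0 < f c ∧ f c < d ∧ Sep S f (f c) c := by
  have hS : Itv S f 0 d = S := by
    ext v
    exact ⟨fun h => h.1, fun h => ⟨h, Nat.zero_le _, L.le v h⟩⟩
  obtain ⟨hcS, _, hn⟩ := hc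
  have hle := L.le c hcS
  have hcon : ¬ (f c = 0 ∨ f c = d ∨ ∃ u ∈ S, u ≠ c ∧ f u = f c) := by
    intro h
    have := core L hx hy (c := c) (by rw [hS]; exact hcS) h
    rw [hS] at this
    exact hn this
  push Not at hcon
  obtain ⟨h1, h2, h3⟩ := hcon
  refine ⟨by omega, by omega, hcS, rfl, fun u uS hu => ?_⟩
  by_contra huc
  exact h3 u uS huc hu

theorem part2 (L : Layered G S f d) [Finite V] {x y : V} (hx : Sep S f 0 x) (hy : Sep S f d y)
    {B : Set V} (hB : IsBlockOn G S B) : {c : V | IsCutVertexOn G S c ∧ c ∈ B}.ncard ≤ 2 := by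
  by_contra! h
  rw [Set.two_lt_ncard_iff (Set.toFinite _)] at h
  obtain ⟨p, q, r, ⟨hp, hpB⟩, ⟨hq, hqB⟩, ⟨hr, hrB⟩, hpq, hpr, hqr⟩ := h
  have sp := (cut_sep L hx hy hp).2.2
  have sq := (cut_sep L hx hy hq).2.2
  have sr := (cut_sep L hx hy hr).2.2
  have npq : f p ≠ f q := fun h => hpq (sq.2.2 p sp.1 h)
  have npr : f p ≠ f r := fun h => hpr (sr.2.2 p sp.1 h)
  have nqr : f q ≠ f r := fun h => hqr (sr.2.2 q sq.1 h)
  have key : ∀ p ∈ B, ∀ q ∈ B, ∀ r ∈ B, Sep S f (f q) q → f p < f q → ¬ f q < f r :=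
    fun p hp q _ r hr sq h1 h2 => no_cross L hB.2.1 hB.1 sq hp hr h1 h2
  have := key p hpB q hqB r hrB sq
  have := key r hrB q hqB p hpB sq
  have := key q hqB p hpB r hrB sp
  have := key r hrB p hpB q hqB sp
  have := key p hpB r hrB q hqB sr
  have := key q hqB r hrB p hpB sr
  omega

theorem part1 (L : Layered G S f d) {x y : V} (hx : Sep S f 0 x) (hy : Sep S f d y)
    {c : V} (hc : IsCutVertexOn G S c) : {B : Set V | IsBlockOn G S B ∧ c ∈ B}.ncard = 2 := by
  classical
  obtain ⟨h0, hd, sc⟩ := cut_sep L hx hy hc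
  obtain ⟨a, ⟨xa, sa⟩, hac, hamax⟩ : ∃ a, (∃ z, Sep S f a z) ∧ a < f c ∧
      ∀ k, a < k → k < f c → ∀ z, ¬ Sep S f k z := by
    let P : ℕ → Prop := fun k => k < f c ∧ ∃ z, Sep S f k z
    have h1 : P (Nat.findGreatest P (f c)) :=
      Nat.findGreatest_spec (P := P) (Nat.zero_le _) ⟨h0, x, hx⟩
    refine ⟨_, h1.2, h1.1, fun k hk hkc z hz => ?_⟩
    exact Nat.findGreatest_is_greatest hk hkc.le ⟨hkc, z, hz⟩
  obtain ⟨b, ⟨xb, sb⟩, hcb, hbmin⟩ : ∃ b, (∃ z, Sep S f b z) ∧ f c < b ∧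
      ∀ k, f c < k → k < b → ∀ z, ¬ Sep S f k z := by
    have hex : ∃ k, f c < k ∧ ∃ z, Sep S f k z := ⟨d, hd, y, hy⟩
    refine ⟨Nat.find hex, (Nat.find_spec hex).2, (Nat.find_spec hex).1, fun k hk hkb z hz => ?_⟩
    exact Nat.find_min hex hkb ⟨hk, z, hz⟩
  have b1 := itv_block L sa sc hac hamax
  have b2 := itv_block L sc sb hcb hbmin
  have fa := sa.2.1
  have fb := sb.2.1
  have : {B : Set V | IsBlockOn G S B ∧ c ∈ B} = {Itv S f a (f c), Itv S f (f c) b} := by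
    ext B
    simp only [Set.mem_ofPred_eq, Set.mem_insert_iff, Set.mem_singleton_iff]
    constructor
    · rintro ⟨hB, hcB⟩
      by_cases hall : ∀ v ∈ B, f v ≤ f c
      · left
        refine (hB.2.2 (Itv S f a (f c)) (fun v hv => ⟨hB.1 hv, ?_, hall v hv⟩) b1.1 b1.2.1).symm
        by_contra! h
        exact no_cross L hB.2.1 hB.1 sa hv hcB h hac
      · right
        push Not at hall
        obtain ⟨w, hw, hwc⟩ := hall
        refine (hB.2.2 (Itv S f (f c) b) (fun v hv => ⟨hB.1 hv, ?_, ?_⟩) b2.1 b2.2.1).symm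
        · by_contra! h
          exact no_cross L hB.2.1 hB.1 sc hv hw h hwc
        · by_contra! h
          exact no_cross L hB.2.1 hB.1 sb hcB hv hcb h
    · rintro (rfl | rfl)
      · exact ⟨b1, sc.1, hac.le, le_rfl⟩
      · exact ⟨b2, sc.1, le_rfl, hcb.le⟩
  rw [this]
  apply Set.ncard_pair
  intro h
  have h1 : xa ∈ Itv S f a (f c) := ⟨sa.1, by omega, by omega⟩
  rw [h] at h1
  have := h1.2.1
  omega

theorem mem_spv (hG : G.Connected) {s t v : V} :
    v ∈ shortestPathVerts G s t ↔ G.dist s v + G.dist v t = G.dist s t := by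
  classical
  constructor
  · rintro ⟨p, _, hl, hv⟩
    have h1 := SimpleGraph.dist_le (p.takeUntil v hv)
    have h2 := SimpleGraph.dist_le (p.dropUntil v hv)
    have h3 := congrArg SimpleGraph.Walk.length (p.take_spec hv)
    rw [SimpleGraph.Walk.length_append] at h3
    have h4 := hG.dist_triangle (u := s) (v := v) (w := t)
    omega
  · intro h
    obtain ⟨p, hp⟩ := hG.exists_walk_length_eq_dist s v
    obtain ⟨q, hq⟩ := hG.exists_walk_length_eq_dist v t
    have hl : (p.append q).length = G.dist s t := by
      rw [SimpleGraph.Walk.length_append]; omega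
    refine ⟨p.append q, SimpleGraph.Walk.isPath_of_length_eq_dist _ hl, hl, ?_⟩
    simp

theorem exists_step (hG : G.Connected) {u v : V} (h : 0 < G.dist u v) :
    ∃ w, G.Adj u w ∧ G.dist w v + 1 = G.dist u v := by
  obtain ⟨p, hp⟩ := hG.exists_walk_length_eq_dist u v
  cases p with
  | nil => simp at h
  | @cons _ w _ hadj q =>
    refine ⟨w, hadj, ?_⟩
    have h1 := SimpleGraph.dist_le q
    have h2 := hG.dist_triangle (u := u) (v := w) (w := v)
    have h3 : G.dist u w = 1 := SimpleGraph.dist_eq_one_iff_adj.2 hadj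
    simp only [SimpleGraph.Walk.length_cons] at hp
    omega

theorem layered (hG : G.Connected) (s t : V) :
    Layered G (shortestPathVerts G s t) (fun v => G.dist s v) (G.dist s t) where
  down := by
    intro v hv h0
    rw [mem_spv hG] at hv
    rw [SimpleGraph.dist_comm] at h0
    obtain ⟨w, hadj, hw⟩ := exists_step hG h0
    have h3 : G.dist w v = 1 := SimpleGraph.dist_eq_one_iff_adj.2 hadj.symm
    have h2 := hG.dist_triangle (u := w) (v := v) (w := t)
    have h4 := hG.dist_triangle (u := s) (v := w) (w := t)
    rw [SimpleGraph.dist_comm, SimpleGraph.dist_comm (u := v)] at hw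
    exact ⟨w, (mem_spv hG).2 (by omega), hadj, hw⟩
  up := by
    intro v hv h0
    rw [mem_spv hG] at hv
    obtain ⟨w, hadj, hw⟩ := exists_step hG (u := v) (v := t) (by omega)
    have h3 : G.dist v w = 1 := SimpleGraph.dist_eq_one_iff_adj.2 hadj
    have h2 := hG.dist_triangle (u := s) (v := v) (w := w)
    have h4 := hG.dist_triangle (u := s) (v := w) (w := t)
    exact ⟨w, (mem_spv hG).2 (by omega), hadj, by omega⟩
  le := by
    intro v hv
    rw [mem_spv hG] at hv
    omega
  lip := by
    intro u v hadj
    have h3 : G.dist v u = 1 := SimpleGraph.dist_eq_one_iff_adj.2 hadj.symm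
    have h2 := hG.dist_triangle (u := s) (v := v) (w := u)
    omega

theorem sep_s (hG : G.Connected) (s t : V) :
    Sep (shortestPathVerts G s t) (fun v => G.dist s v) 0 s :=
  ⟨(mem_spv hG).2 (by simp), by simp, fun _ _ h => (hG.dist_eq_zero_iff.1 h).symm⟩

theorem sep_t (hG : G.Connected) (s t : V) :
    Sep (shortestPathVerts G s t) (fun v => G.dist s v) (G.dist s t) t :=
  ⟨(mem_spv hG).2 (by simp), rfl, fun y hy h => by
    rw [mem_spv hG] at hy
    dsimp only at h
    exact hG.dist_eq_zero_iff.1 (by omega)⟩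

end Stmt7

/-- The block structure of `H = G[S₀(s,t)]` is a path: every cut vertex of `H` belongs
to exactly two blocks, and every block of `H` contains at most two cut vertices. -/
theorem stmt_7 {V : Type*} [Fintype V] (G : SimpleGraph V) (hG : G.Connected)
    (s t : V) (hst : s ≠ t) :
    (∀ c : V, IsCutVertexOn G (shortestPathVerts G s t) c →
      {B : Set V | IsBlockOn G (shortestPathVerts G s t) B ∧ c ∈ B}.ncard = 2) ∧
    (∀ B : Set V, IsBlockOn G (shortestPathVerts G s t) B →
      {c : V | IsCutVertexOn G (shortestPathVerts G s t) c ∧ c ∈ B}.ncard ≤ 2) := by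
  exact ⟨fun c hc => Stmt7.part1 (Stmt7.layered hG s t) (Stmt7.sep_s hG s t)
      (Stmt7.sep_t hG s t) hc,
    fun B hB => Stmt7.part2 (Stmt7.layered hG s t) (Stmt7.sep_s hG s t) (Stmt7.sep_t hG s t) hB⟩
end
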